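/- arXiv:2501.01571 — 2 statements merged into one kernel-verified Lean document; each statement's English description precedes it below -/
import Mathlib

section
/- Let S ⊆ ℤ be a finite nonempty set, let A_∞ be the set produced by the greedy packing algorithm for S, and let a < b be integers such that A_∞ is a-forward-periodic with period b - a. Define A ⊆ ℤ by: x ∈ A if and only if a + r(x) ∈ A_∞, where r(x) is the unique integer with 0 ≤ r(x) < b - a and x - a ≡ r(x) (mod b - a). Then the density d(A) exists (the upper and lower densities of A coincide) and d(A) ≥ 1/|diff(S)|. -/
open Pointwise Filter

/-- The difference set of `S`: `{s - t : s, t ∈ S, s ≥ t}`. -/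
def diffSet (S : Set ℤ) : Set ℤ := {d | ∃ s ∈ S, ∃ t ∈ S, t ≤ s ∧ d = s - t}

/-- `A` is `S`-packing if translates `S + a₁` and `S + a₂` are disjoint for distinct `a₁, a₂ ∈ A`. -/
def SPacking (S A : Set ℤ) : Prop :=
  ∀ a₁ ∈ A, ∀ a₂ ∈ A, a₁ ≠ a₂ →
    Disjoint ((fun s => s + a₁) '' S) ((fun s => s + a₂) '' S)

/-- Upper density of `A ⊆ ℤ`. -/
noncomputable def upperDensity (A : Set ℤ) : ℝ :=
  limsup (fun n : ℕ => ((A ∩ Set.Icc (-(n : ℤ)) (n : ℤ)).ncard : ℝ) / (2 * n + 1)) atTop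

/-- Lower density of `A ⊆ ℤ`. -/
noncomputable def lowerDensity (A : Set ℤ) : ℝ :=
  liminf (fun n : ℕ => ((A ∩ Set.Icc (-(n : ℤ)) (n : ℤ)).ncard : ℝ) / (2 * n + 1)) atTop

/-- Packing density of `S`: supremum of upper densities of `S`-packing sets. -/
noncomputable def packingDensity (S : Set ℤ) : ℝ :=
  sSup {d : ℝ | ∃ A : Set ℤ, SPacking S A ∧ d = upperDensity A}

/-- `t`, `A` are the sequences produced by the greedy packing algorithm for `S`:
`A₋₁ = ∅`, and for `i ≥ 0`, `tᵢ = min {x : x ≥ 0, x ∉ Aᵢ₋₁ + diff S}` and `Aᵢ = Aᵢ₋₁ ∪ {tᵢ}`. -/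
def GreedySeq (S : Set ℤ) (t : ℕ → ℤ) (A : ℕ → Set ℤ) : Prop :=
  IsLeast {x : ℤ | 0 ≤ x ∧ x ∉ (∅ : Set ℤ) + diffSet S} (t 0) ∧
  (∀ i : ℕ, IsLeast {x : ℤ | 0 ≤ x ∧ x ∉ A i + diffSet S} (t (i + 1))) ∧
  A 0 = (∅ : Set ℤ) ∪ {t 0} ∧
  (∀ i : ℕ, A (i + 1) = A i ∪ {t (i + 1)})

/-- `A` is `a`-forward-periodic with period `p`. -/
def FwdPeriodic (A : Set ℤ) (a p : ℤ) : Prop :=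
  ∀ i : ℤ, 0 ≤ i → ((a + i ∈ A) ↔ (a + i + p ∈ A))

/-- Interval density of `A` restricted to `[a, b-1]`. -/
noncomputable def intervalDensity (A : Set ℤ) (a b : ℤ) : ℝ :=
  ((A ∩ Set.Icc a (b - 1)).ncard : ℝ) / ((b : ℝ) - a)

/-- Every nonnegative integer is covered by the translates of `diffSet S` by the greedy set. -/
theorem GreedySeq.mem_iUnion_add_diffSet {S : Set ℤ} (hne : S.Nonempty) {t : ℕ → ℤ}
    {As : ℕ → Set ℤ} (hg : GreedySeq S t As) {x : ℤ} (hx : 0 ≤ x) :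
    x ∈ (⋃ i, As i) + diffSet S := by
  by_contra hcon
  obtain ⟨-, hmin, h0, hsucc⟩ := hg
  have zero_mem : (0 : ℤ) ∈ diffSet S := by
    obtain ⟨s, hs⟩ := hne
    exact ⟨s, hs, s, hs, le_rfl, by simp⟩
  have not_mem (i : ℕ) : x ∉ As i + diffSet S := fun h =>
    hcon (Set.add_subset_add_right (Set.subset_iUnion As i) h)
  have mono : Monotone As := monotone_nat_of_le_succ fun i => by
    rw [hsucc]
    exact Set.subset_union_left
  have t_mem (i : ℕ) : t i ∈ As i := by
    cases i with
    | zero => simp [h0]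
    | succ i => simp [hsucc]
  have t_not_mem (i : ℕ) : t (i + 1) ∉ As i := fun h =>
    (hmin i).1.2 (Set.mem_add.2 ⟨_, h, 0, zero_mem, add_zero _⟩)
  have t_ne {i j : ℕ} (hij : i < j) : t i ≠ t j := fun h => by
    obtain ⟨k, rfl⟩ : ∃ k, j = k + 1 := ⟨j - 1, by omega⟩
    exact t_not_mem k (h ▸ mono (Nat.lt_succ_iff.1 hij) (t_mem i))
  have inj : Function.Injective fun i => t (i + 1) := fun i j h => by
    rcases lt_trichotomy i j with hij | hij | hij
    · exact absurd h (t_ne (by omega))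
    · exact hij
    · exact absurd h.symm (t_ne (by omega))
  exact Set.infinite_of_injective_forall_mem (s := Set.Icc 0 x) inj
    (fun i => ⟨(hmin i).1.1, (hmin i).2 ⟨hx, not_mem i⟩⟩) (Set.finite_Icc 0 x)

theorem diffSet_finite {S : Set ℤ} (hfin : S.Finite) : (diffSet S).Finite := by
  refine (hfin.sub hfin).subset ?_
  rintro _ ⟨s, hs, t, ht, -, rfl⟩
  exact Set.sub_mem_sub hs ht

theorem diffSet_nonempty {S : Set ℤ} (hne : S.Nonempty) : (diffSet S).Nonempty := by
  obtain ⟨s, hs⟩ := hne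
  exact ⟨s - s, s, hs, s, hs, le_rfl, rfl⟩

theorem FwdPeriodic.mem_iff_add_emod_mem {A : Set ℤ} {a p : ℤ} (hA : FwdPeriodic A a p)
    (hp : 0 < p) {x : ℤ} (hx : a ≤ x) : x ∈ A ↔ a + (x - a) % p ∈ A := by
  have key (r : ℤ) (hr : 0 ≤ r) (k : ℕ) : a + r ∈ A ↔ a + r + k * p ∈ A := by
    induction k with
    | zero => simp
    | succ k ih =>
      rw [ih, add_assoc, hA (r + k * p) (by positivity)]
      push_cast
      ring_nf
  obtain ⟨k, hk⟩ := Int.eq_ofNat_of_zero_le (Int.ediv_nonneg (sub_nonneg.2 hx) hp.le)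
  rw [key _ (Int.emod_nonneg _ hp.ne') k, ← hk]
  have := Int.emod_add_mul_ediv (x - a) p
  rw [show a + (x - a) % p + (x - a) / p * p = x by linarith]

/-- The number of points of a residue class in an interval, up to an error of one. -/
theorem abs_card_filter_modEq_Ico_sub_le {u w p : ℤ} (v : ℤ) (huw : u ≤ w) (hp : 0 < p) :
    |(((Finset.Ico u w).filter (· ≡ v [ZMOD p])).card : ℝ) - (w - u) / p| ≤ 1 := by
  have h := Int.Ico_filter_modEq_card u w hp v
  have hle : ⌈((u - v : ℤ) : ℚ) / p⌉ ≤ ⌈((w - v : ℤ) : ℚ) / p⌉ := by gcongr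
  push_cast at hle
  rw [max_eq_left (by linarith)] at h
  have hQ : |(((Finset.Ico u w).filter (· ≡ v [ZMOD p])).card : ℚ) - (w - u) / p| ≤ 1 := by
    have h' : (((Finset.Ico u w).filter (· ≡ v [ZMOD p])).card : ℚ) =
        (⌈((w : ℚ) - v) / p⌉ : ℚ) - ⌈((u : ℚ) - v) / p⌉ := by exact_mod_cast h
    have h1 := Int.le_ceil (((w : ℚ) - v) / p)
    have h2 := Int.ceil_lt_add_one (((w : ℚ) - v) / p)
    have h3 := Int.le_ceil (((u : ℚ) - v) / p)
    have h4 := Int.ceil_lt_add_one (((u : ℚ) - v) / p)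
    have h5 : ((w : ℚ) - u) / p = (w - v) / p - (u - v) / p := by ring
    rw [h', h5, abs_le]
    constructor <;> linarith
  exact_mod_cast hQ

/-- A union of `R.card` residue classes modulo `p` has density `R.card / p`. -/
theorem tendsto_density_of_residues {A : Set ℤ} {a p : ℤ} (hp : 0 < p) {R : Finset ℤ}
    (hR : R ⊆ Finset.Ico a (a + p)) (hA : ∀ x, x ∈ A ↔ a + (x - a) % p ∈ R) :
    Tendsto (fun n : ℕ => ((A ∩ Set.Icc (-(n : ℤ)) (n : ℤ)).ncard : ℝ) / (2 * n + 1)) atTop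
      (nhds ((R.card : ℝ) / p)) := by
  have class_iff {v : ℤ} (hv : v ∈ R) (x : ℤ) : x ≡ v [ZMOD p] ↔ a + (x - a) % p = v := by
    have hv' := Finset.mem_Ico.1 (hR hv)
    have h1 : (v - a) % p = v - a := Int.emod_eq_of_lt (by omega) (by omega)
    constructor
    · intro h
      have h2 : (x - a) % p = (v - a) % p := h.sub_right a
      omega
    · intro h
      have h2 : x - a ≡ v - a [ZMOD p] := by
        rw [Int.ModEq, h1]
        omega
      simpa using h2.add_right a
  have count (n : ℕ) : (A ∩ Set.Icc (-(n : ℤ)) n).ncard =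
      ∑ v ∈ R, ((Finset.Ico (-(n : ℤ)) (n + 1)).filter (· ≡ v [ZMOD p])).card := by
    rw [← Finset.card_biUnion, ← Set.ncard_coe_finset]
    · congr 1
      ext x
      simp only [Set.mem_inter_iff, Set.mem_Icc, Finset.coe_biUnion, Set.mem_iUnion,
        Finset.mem_coe, Finset.mem_filter, Finset.mem_Ico, Int.lt_add_one_iff, exists_prop, hA]
      constructor
      · rintro ⟨h, hx⟩
        exact ⟨_, h, hx, (class_iff h x).2 rfl⟩
      · rintro ⟨v, hv, hx, h⟩
        exact ⟨(class_iff hv x).1 h ▸ hv, hx⟩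
    · intro v hv w hw hvw
      refine Finset.disjoint_left.2 fun x hx hx' => hvw ?_
      rw [← (class_iff hv x).1 (Finset.mem_filter.1 hx).2,
        (class_iff hw x).1 (Finset.mem_filter.1 hx').2]
  have error (n : ℕ) : |((A ∩ Set.Icc (-(n : ℤ)) n).ncard : ℝ) / (2 * n + 1) - R.card / p| ≤
      R.card / (2 * n + 1) := by
    have hn : (0 : ℝ) < 2 * n + 1 := by positivity
    have hsum : |((A ∩ Set.Icc (-(n : ℤ)) n).ncard : ℝ) - R.card * ((2 * n + 1) / p)| ≤
        R.card := by
      rw [count, Nat.cast_sum, ← nsmul_eq_mul, ← Finset.sum_const, ← Finset.sum_sub_distrib]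
      refine (Finset.abs_sum_le_sum_abs _ _).trans ?_
      refine (Finset.sum_le_card_nsmul R _ 1 fun v _ => ?_).trans_eq (by simp)
      have := abs_card_filter_modEq_Ico_sub_le v (u := -(n : ℤ)) (w := n + 1) (by omega) hp
      push_cast at this
      rwa [show (n : ℝ) + 1 - -n = 2 * n + 1 by ring] at this
    rw [le_div_iff₀ hn, ← abs_of_pos hn, ← abs_mul, abs_of_pos hn, sub_mul,
      div_mul_cancel₀ _ hn.ne', div_mul_eq_mul_div, mul_div_assoc]
    exact hsum
  refine tendsto_iff_norm_sub_tendsto_zero.2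
    (squeeze_zero (fun _ => norm_nonneg _) error (Tendsto.div_atTop tendsto_const_nhds ?_))
  exact tendsto_atTop_add_const_right _ _
    (tendsto_natCast_atTop_atTop.const_mul_atTop two_pos)

/-- If a forward periodic set `B` satisfies `[0, ∞) ⊆ B + D` with `D` finite, then the residues of
one period of `B` translated by `D` cover all residues. -/
theorem FwdPeriodic.le_card_mul_card {B : Set ℤ} {a p : ℤ} (hB : FwdPeriodic B a p) (hp : 0 < p)
    {D : Finset ℤ} (hcover : ∀ x : ℤ, 0 ≤ x → x ∈ B + (D : Set ℤ)) {R : Finset ℤ}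
    (hR : ∀ x, x ∈ R ↔ x ∈ Finset.Ico a (a + p) ∧ x ∈ B) :
    p ≤ R.card * D.card := by
  obtain ⟨M, hM⟩ := D.bddAbove
  have hsub : Finset.Ico a (a + p) ⊆
      (R ×ˢ D).image fun q => a + (q.1 + q.2 - a) % p := by
    intro y hy
    obtain ⟨hy1, hy2⟩ := Finset.mem_Ico.1 hy
    have hk : |M| + |a| ≤ (|M| + |a|) * p := le_mul_of_one_le_right (by positivity) hp
    have hMabs := le_abs_self M
    have haabs := neg_abs_le a
    have hM0 := abs_nonneg M
    have ha0 := abs_nonneg a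
    obtain ⟨c, hc, d, hd, hcd⟩ := hcover (y + (|M| + |a|) * p) (by linarith)
    have hdM : d ≤ M := hM hd
    have hcd' : c + d = y + (|M| + |a|) * p := hcd
    have hac : a ≤ c := by linarith
    refine Finset.mem_image.2 ⟨(a + (c - a) % p, d), Finset.mem_product.2 ⟨(hR _).2 ⟨?_, ?_⟩, hd⟩, ?_⟩
    · have h1 := Int.emod_nonneg (c - a) hp.ne'
      have h2 := Int.emod_lt_of_pos (c - a) hp
      exact Finset.mem_Ico.2 ⟨by omega, by omega⟩
    · exact (hB.mem_iff_add_emod_mem hp hac).1 hc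
    · have h1 : a + (c - a) % p + d - a = (c - a) % p + d := by ring
      have h2 : c - a + d = y - a + (|M| + |a|) * p := by linarith
      simp only [h1]
      rw [Int.emod_add_emod, h2, Int.add_mul_emod_self_right,
        Int.emod_eq_of_lt (by omega) (by omega)]
      ring
  have hcard := (Finset.card_le_card hsub).trans Finset.card_image_le
  rw [Int.card_Ico, Finset.card_product] at hcard
  have : ((a + p - a).toNat : ℤ) ≤ R.card * D.card := by exact_mod_cast hcard
  omega

theorem stmt8 (S : Set ℤ) (hfin : S.Finite) (hne : S.Nonempty)
    (t : ℕ → ℤ) (As : ℕ → Set ℤ) (hg : GreedySeq S t As)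
    (Ainf : Set ℤ) (hAinf : Ainf = ⋃ i : ℕ, As i)
    (a b : ℤ) (hab : a < b) (hp : FwdPeriodic Ainf a (b - a))
    (A : Set ℤ) (hA : ∀ x : ℤ, x ∈ A ↔ a + (x - a) % (b - a) ∈ Ainf) :
    upperDensity A = lowerDensity A ∧
    1 / ((diffSet S).ncard : ℝ) ≤ upperDensity A := by
  classical
  have hpos : 0 < b - a := sub_pos.2 hab
  set R := (Finset.Ico a (a + (b - a))).filter (· ∈ Ainf) with hR
  have hAR (x : ℤ) : x ∈ A ↔ a + (x - a) % (b - a) ∈ R := by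
    have h1 := Int.emod_nonneg (x - a) hpos.ne'
    have h2 := Int.emod_lt_of_pos (x - a) hpos
    rw [hA, hR, Finset.mem_filter, Finset.mem_Ico]
    exact ⟨fun h => ⟨⟨by omega, by omega⟩, h⟩, And.right⟩
  have hlim := tendsto_density_of_residues hpos (Finset.filter_subset _ _) hAR
  have hD := diffSet_finite hfin
  have hle := hp.le_card_mul_card hpos (D := hD.toFinset) (R := R)
    (fun x hx => by
      rw [hD.coe_toFinset, hAinf]
      exact hg.mem_iUnion_add_diffSet hne hx)
    (fun x => Finset.mem_filter)
  rw [← Set.ncard_eq_toFinset_card _ hD] at hle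
  refine ⟨hlim.limsup_eq.trans hlim.liminf_eq.symm, ?_⟩
  rw [upperDensity, hlim.limsup_eq, div_le_div_iff₀, one_mul]
  · exact_mod_cast hle
  · exact_mod_cast (Set.ncard_pos hD).2 (diffSet_nonempty hne)
  · exact_mod_cast hpos
end

section
/- If S is a set of integers with cardinality four, then d_p(S) ≥ 1/7. -/
open Pointwise Filter

theorem zero_mem_diffSet {S : Set ℤ} (hS : S.Nonempty) : (0 : ℤ) ∈ diffSet S := by
  obtain ⟨s, hs⟩ := hS
  exact ⟨s, hs, s, hs, le_rfl, by simp⟩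

/-- A set of four integers has at most seven nonnegative differences. -/
theorem exists_diffSet_eq_coe (S : Set ℤ) (hS : S.ncard = 4) :
    ∃ D : Finset ℤ, (D : Set ℤ) = diffSet S ∧ D.card ≤ 7 := by
  have hfin : S.Finite := Set.finite_of_ncard_ne_zero (by omega)
  lift S to Finset ℤ using hfin
  rw [Set.ncard_coe_finset] at hS
  set f := S.orderEmbOfFin hS
  have hmem : ∀ i, f i ∈ S := S.orderEmbOfFin_mem hS
  have hsurj : ∀ s ∈ S, ∃ i, f i = s := by
    intro s hs
    have h : s ∈ Set.range f := by rw [S.range_orderEmbOfFin hS]; exact hs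
    exact h
  let P : Finset (Fin 4 × Fin 4) := Finset.univ.filter fun p => p.1 < p.2
  have hP : P.card = 6 := by decide
  refine ⟨insert 0 (P.image fun p => f p.2 - f p.1), ?_, ?_⟩
  · ext d
    simp only [Finset.mem_coe, Finset.mem_insert, Finset.mem_image, P, Finset.mem_filter,
      Finset.mem_univ, true_and, diffSet, Set.mem_ofPred_eq]
    constructor
    · rintro (rfl | ⟨⟨i, j⟩, hij, rfl⟩)
      · exact ⟨f 0, hmem 0, f 0, hmem 0, le_rfl, by simp⟩
      · exact ⟨f j, hmem j, f i, hmem i, f.monotone hij.le, rfl⟩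
    · rintro ⟨s, hs, t, ht, hts, rfl⟩
      obtain ⟨i, rfl⟩ := hsurj s hs
      obtain ⟨j, rfl⟩ := hsurj t ht
      rcases (f.le_iff_le.1 hts).eq_or_lt with rfl | h
      · simp
      · exact Or.inr ⟨(j, i), h, rfl⟩
  · calc _ ≤ (P.image fun p => f p.2 - f p.1).card + 1 := Finset.card_insert_le _ _
      _ ≤ P.card + 1 := Nat.add_le_add_right Finset.card_image_le 1
      _ = 7 := by rw [hP]

theorem sPacking_of_sub_notMem_diffSet {S A : Set ℤ}
    (h : ∀ a ∈ A, ∀ b ∈ A, a < b → b - a ∉ diffSet S) : SPacking S A := by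
  intro a ha b hb hab
  rw [Set.disjoint_left]
  rintro _ ⟨s, hs, rfl⟩ ⟨t, ht, hst⟩
  have hst : t + b = s + a := hst
  rcases lt_or_gt_of_ne hab with hlt | hlt
  · exact h a ha b hb hlt ⟨s, hs, t, ht, by omega, by omega⟩
  · exact h b hb a ha hlt ⟨t, ht, s, hs, by omega, by omega⟩

theorem ncard_inter_Icc_div_le_one (A : Set ℤ) (n : ℕ) :
    ((A ∩ Set.Icc (-(n : ℤ)) (n : ℤ)).ncard : ℝ) / (2 * n + 1) ≤ 1 := by
  rw [div_le_one (by positivity)]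
  have h := Set.ncard_le_ncard (Set.inter_subset_right (s := A)) (Set.finite_Icc (-(n : ℤ)) n)
  rw [← Finset.coe_Icc, Set.ncard_coe_finset, Int.card_Icc] at h
  have h' : (A ∩ Finset.Icc (-(n : ℤ)) (n : ℤ)).ncard ≤ 2 * n + 1 := by omega
  rw [← Finset.coe_Icc]
  exact_mod_cast h'

theorem isBoundedUnder_le_ncard_inter_Icc_div (A : Set ℤ) :
    IsBoundedUnder (· ≤ ·) atTop
      (fun n : ℕ => ((A ∩ Set.Icc (-(n : ℤ)) (n : ℤ)).ncard : ℝ) / (2 * n + 1)) :=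
  isBoundedUnder_of ⟨1, ncard_inter_Icc_div_le_one A⟩

theorem upperDensity_le_one (A : Set ℤ) : upperDensity A ≤ 1 := by
  refine limsup_le_of_le ?_ (Eventually.of_forall (ncard_inter_Icc_div_le_one A))
  exact (isBoundedUnder_of ⟨0, fun n => by positivity⟩ :
    IsBoundedUnder (· ≥ ·) atTop _).isCoboundedUnder_le

theorem upperDensity_le_packingDensity {S A : Set ℤ} (h : SPacking S A) :
    upperDensity A ≤ packingDensity S := by
  refine le_csSup ⟨1, ?_⟩ ⟨A, h, rfl⟩
  rintro _ ⟨B, -, rfl⟩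
  exact upperDensity_le_one B

theorem le_upperDensity_of_le_ncard {A : Set ℤ} {c : ℕ} (M : ℕ)
    (h : ∀ n : ℕ, 2 * n + 1 ≤ c * (A ∩ Set.Icc (-(n : ℤ)) (n : ℤ)).ncard + M) :
    (1 / c : ℝ) ≤ upperDensity A := by
  have hc : (0 : ℝ) < c := by
    rcases Nat.eq_zero_or_pos c with rfl | hc
    · have := h M
      omega
    · exact_mod_cast hc
  have hlim : Tendsto (fun n : ℕ => (1 / c : ℝ) - M / c * (1 / (2 * n + 1))) atTop
      (nhds (1 / c)) := by
    have h0 : Tendsto (fun n : ℕ => (1 / (2 * n + 1) : ℝ)) atTop (nhds 0) := by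
      simp only [one_div]
      refine tendsto_inv_atTop_zero.comp (tendsto_atTop_add_const_right _ _ ?_)
      exact tendsto_natCast_atTop_atTop.const_mul_atTop two_pos
    simpa using (h0.const_mul (M / c : ℝ)).const_sub (1 / c : ℝ)
  rw [← hlim.limsup_eq]
  refine limsup_le_limsup (Eventually.of_forall fun n => ?_) hlim.isCoboundedUnder_le
    (isBoundedUnder_le_ncard_inter_Icc_div A)
  have hn : (2 * n + 1 : ℝ) ≤ c * (A ∩ Set.Icc (-(n : ℤ)) (n : ℤ)).ncard + M := by
    exact_mod_cast h n
  have hpos : (0 : ℝ) < 2 * n + 1 := by positivity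
  have heq : (1 / c : ℝ) - M / c * (1 / (2 * n + 1)) = (2 * n + 1 - M) / c / (2 * n + 1) := by
    field_simp
  change (1 / c : ℝ) - M / c * (1 / (2 * n + 1)) ≤ _
  rw [heq]
  refine div_le_div_of_nonneg_right ?_ hpos.le
  rw [div_le_iff₀ hc]
  linarith

/-- Membership in the greedy set of naturals with no positive difference in `D`. -/
def GreedyMem (D : Set ℤ) (n : ℕ) : Prop :=
  ∀ m : ℕ, m < n → GreedyMem D m → (n : ℤ) - m ∉ D
termination_by n

theorem greedyMem_iff {D : Set ℤ} {n : ℕ} :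
    GreedyMem D n ↔ ∀ m < n, GreedyMem D m → (n : ℤ) - m ∉ D := by
  rw [GreedyMem]

open Classical in
/-- Every natural number is covered by a translate of `D` by an element of the greedy set. -/
theorem le_card_mul_card_greedy {D : Set ℤ} {F : Finset ℤ} (hF : (F : Set ℤ) = D)
    (h0 : (0 : ℤ) ∈ D) (k : ℕ) :
    k ≤ F.card * ((Finset.range k).filter (GreedyMem D)).card := by
  let G : Finset ℤ := ((Finset.range k).filter (GreedyMem D)).image (fun n : ℕ => (n : ℤ))
  have hsub : (Finset.range k).image (fun n : ℕ => (n : ℤ)) ⊆ F + G := by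
    intro x hx
    obtain ⟨n, hn, rfl⟩ := Finset.mem_image.1 hx
    rw [Finset.mem_range] at hn
    obtain ⟨m, hm, hmk, hmD⟩ : ∃ m, GreedyMem D m ∧ m < k ∧ (n : ℤ) - m ∈ D := by
      by_cases hg : GreedyMem D n
      · exact ⟨n, hg, hn, by simpa using h0⟩
      · rw [greedyMem_iff] at hg
        push Not at hg
        obtain ⟨m, hmn, hm, hmD⟩ := hg
        exact ⟨m, hm, hmn.trans hn, hmD⟩
    rw [← hF] at hmD
    refine Finset.mem_add.2 ⟨_, hmD, m, ?_, by simp⟩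
    exact Finset.mem_image_of_mem _ (Finset.mem_filter.2 ⟨Finset.mem_range.2 hmk, hm⟩)
  calc k = ((Finset.range k).image (fun n : ℕ => (n : ℤ))).card := by
        rw [Finset.card_image_of_injective _ Nat.cast_injective, Finset.card_range]
    _ ≤ (F + G).card := Finset.card_le_card hsub
    _ ≤ F.card * G.card := Finset.card_add_le
    _ ≤ _ := Nat.mul_le_mul_left _ Finset.card_image_le

/-- The greedy set together with its reflection, shifted so that the two halves are more than
`M` apart. -/
def doubledGreedy (D : Set ℤ) (M : ℕ) : Set ℤ :=
  {x | ∃ n : ℕ, GreedyMem D n ∧ (x = n ∨ x = -(M + 1 + n : ℤ))}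

theorem sub_notMem_of_mem_doubledGreedy {D : Set ℤ} {M : ℕ} (hM : ∀ d ∈ D, d ≤ M) :
    ∀ a ∈ doubledGreedy D M, ∀ b ∈ doubledGreedy D M, a < b → b - a ∉ D := by
  rintro a ⟨m, hm, rfl | rfl⟩ b ⟨n, hn, rfl | rfl⟩ hab
  · exact greedyMem_iff.1 hn m (by omega) hm
  · omega
  · intro h
    have := hM _ h
    omega
  · have h := greedyMem_iff.1 hm n (by omega) hn
    rwa [show -(M + 1 + n : ℤ) - -(M + 1 + m : ℤ) = m - n by ring]

open Classical in
theorem le_ncard_doubledGreedy {D : Set ℤ} {c : ℕ} (M : ℕ)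
    (hc : ∀ k : ℕ, k ≤ c * ((Finset.range k).filter (GreedyMem D)).card) (n : ℕ) :
    2 * n + 1 ≤ c * (doubledGreedy D M ∩ Set.Icc (-(n : ℤ)) (n : ℤ)).ncard + M := by
  let P : Finset ℤ :=
    ((Finset.range (n + 1)).filter (GreedyMem D)).image (fun i : ℕ => (i : ℤ))
  let N : Finset ℤ :=
    ((Finset.range (n - M)).filter (GreedyMem D)).image (fun i : ℕ => -(M + 1 + i : ℤ))
  have hP : P.card = ((Finset.range (n + 1)).filter (GreedyMem D)).card :=
    Finset.card_image_of_injective _ Nat.cast_injective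
  have hN : N.card = ((Finset.range (n - M)).filter (GreedyMem D)).card :=
    Finset.card_image_of_injective _ fun i j hij => by
      omega
  have hdisj : Disjoint P N := by
    rw [Finset.disjoint_left]
    intro x hxP hxN
    obtain ⟨i, -, rfl⟩ := Finset.mem_image.1 hxP
    obtain ⟨j, -, hj⟩ := Finset.mem_image.1 hxN
    omega
  have hsub : ((P ∪ N : Finset ℤ) : Set ℤ) ⊆
      doubledGreedy D M ∩ Set.Icc (-(n : ℤ)) (n : ℤ) := by
    intro x hx
    rcases Finset.mem_union.1 hx with hx | hx
    · obtain ⟨i, hi, rfl⟩ := Finset.mem_image.1 hx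
      rw [Finset.mem_filter, Finset.mem_range] at hi
      exact ⟨⟨i, hi.2, Or.inl rfl⟩, by constructor <;> omega⟩
    · obtain ⟨i, hi, rfl⟩ := Finset.mem_image.1 hx
      rw [Finset.mem_filter, Finset.mem_range] at hi
      exact ⟨⟨i, hi.2, Or.inr rfl⟩, by constructor <;> omega⟩
  have hcard := Set.ncard_le_ncard hsub ((Set.finite_Icc _ _).inter_of_right _)
  rw [Set.ncard_coe_finset, Finset.card_union_of_disjoint hdisj, hP, hN] at hcard
  have h1 := hc (n + 1)
  have h2 := hc (n - M)
  have h3 := Nat.mul_le_mul_left c hcard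
  rw [Nat.mul_add] at h3
  omega

theorem stmt11 (S : Set ℤ) (hS : S.ncard = 4) : 1 / 7 ≤ packingDensity S := by
  have hne : S.Nonempty := Set.nonempty_of_ncard_ne_zero (by omega)
  obtain ⟨D, hDS, hD⟩ := exists_diffSet_eq_coe S hS
  obtain ⟨M, hM⟩ : ∃ M : ℕ, ∀ d ∈ diffSet S, d ≤ M := by
    obtain ⟨m, hm⟩ := D.bddAbove
    refine ⟨m.toNat, fun d hd => ?_⟩
    rw [← hDS] at hd
    exact (hm hd).trans (Int.self_le_toNat m)
  calc (1 / 7 : ℝ) ≤ upperDensity (doubledGreedy (diffSet S) M) := by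
        refine le_upperDensity_of_le_ncard M fun n => ?_
        refine le_ncard_doubledGreedy M (fun k => ?_) n
        exact (le_card_mul_card_greedy hDS (zero_mem_diffSet hne) k).trans
          (Nat.mul_le_mul_right _ hD)
    _ ≤ packingDensity S :=
        upperDensity_le_packingDensity (sPacking_of_sub_notMem_diffSet
          (sub_notMem_of_mem_doubledGreedy hM))
end
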